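/- arXiv:1206.6573 — 7 statements merged into one kernel-verified Lean document; each statement's English description precedes it below -/
import Mathlib

section
/- For every first-order formula ψ (containing no dependence atoms) over a signature Σ, every model M of Σ, and every team X over M with Free(ψ) ⊆ Dom(X): (M,X) ⊨⁺ ψ if and only if M ⊨_s ψ in the sense of Tarski semantics for every s ∈ X, and (M,X) ⊨⁻ ψ if and only if M ⊭_s ψ in the sense of Tarski semantics for every s ∈ X. -/
/-! ## Dependence Logic: syntax, Tarski semantics, Team Semantics,
    Paraconsistent Team Semantics.

Variable assignments are total functions `ℕ → M.Dom`, so every team has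
domain the set of all variables, and conditions like `Free(ψ) ⊆ Dom(X)`
hold automatically. The team `{∅}` consisting of the empty assignment is
represented by the singleton team of a fixed (arbitrary) assignment. -/

/-- A first-order signature: relation and function symbols with arities. -/
structure Signature : Type 1 where
  Rel : Type
  relArity : Rel → ℕ
  Func : Type
  funcArity : Func → ℕ

/-- First-order terms over a signature, with variables indexed by `ℕ`. -/
inductive Term (Sig : Signature) : Type where
  | var : ℕ → Term Sig
  | func : (f : Sig.Func) → (Fin (Sig.funcArity f) → Term Sig) → Term Sig

/-- A first-order model for a signature (with nonempty domain). -/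
structure Model (Sig : Signature) : Type 1 where
  Dom : Type
  nonempty : Nonempty Dom
  relInterp : (R : Sig.Rel) → (Fin (Sig.relArity R) → Dom) → Prop
  funcInterp : (f : Sig.Func) → (Fin (Sig.funcArity f) → Dom) → Dom

variable {Sig : Signature}

/-- Evaluation of a term under an assignment. -/
def Term.eval (M : Model Sig) (s : ℕ → M.Dom) : Term Sig → M.Dom
  | .var v => s v
  | .func f ts => M.funcInterp f (fun i => (ts i).eval M s)

/-- The set of variables occurring in a term. -/
def Term.vars : Term Sig → Set ℕ
  | .var v => {v}
  | .func _ ts => ⋃ i, (ts i).vars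

/-- Formulas of Dependence Logic: first-order atoms `R t⃗` and `t₁ = t₂`,
dependence atoms `=(t⃗₁, t⃗₂)`, negation, disjunction, existential
quantification. -/
inductive DLFormula (Sig : Signature) : Type where
  | rel : (R : Sig.Rel) → (Fin (Sig.relArity R) → Term Sig) → DLFormula Sig
  | eq : Term Sig → Term Sig → DLFormula Sig
  | dep : (n m : ℕ) → (Fin n → Term Sig) → (Fin m → Term Sig) → DLFormula Sig
  | neg : DLFormula Sig → DLFormula Sig
  | or : DLFormula Sig → DLFormula Sig → DLFormula Sig
  | ex : ℕ → DLFormula Sig → DLFormula Sig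

/-- `ψ ∧ θ` abbreviates `¬(¬ψ ∨ ¬θ)`. -/
def DLFormula.conj (ψ θ : DLFormula Sig) : DLFormula Sig := (ψ.neg.or θ.neg).neg

/-- `∀v ψ` abbreviates `¬∃v ¬ψ`. -/
def DLFormula.all (v : ℕ) (ψ : DLFormula Sig) : DLFormula Sig := ((ψ.neg).ex v).neg

/-- Free variables of a Dependence Logic formula. -/
def DLFormula.free : DLFormula Sig → Set ℕ
  | .rel _ ts => ⋃ i, (ts i).vars
  | .eq t₁ t₂ => t₁.vars ∪ t₂.vars
  | .dep _ _ ts₁ ts₂ => (⋃ i, (ts₁ i).vars) ∪ ⋃ j, (ts₂ j).vars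
  | .neg ψ => ψ.free
  | .or ψ θ => ψ.free ∪ θ.free
  | .ex v ψ => ψ.free \ {v}

/-- A formula is first-order if it contains no dependence atoms. -/
def DLFormula.IsFirstOrder : DLFormula Sig → Prop
  | .rel _ _ => True
  | .eq _ _ => True
  | .dep _ _ _ _ => False
  | .neg ψ => ψ.IsFirstOrder
  | .or ψ θ => ψ.IsFirstOrder ∧ θ.IsFirstOrder
  | .ex _ ψ => ψ.IsFirstOrder

/-- Tarski satisfaction `M ⊨_s ψ` (meaningful for first-order formulas;
dependence atoms are given the trivial interpretation). -/
def Tarski (M : Model Sig) (s : ℕ → M.Dom) : DLFormula Sig → Prop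
  | .rel R ts => M.relInterp R (fun i => (ts i).eval M s)
  | .eq t₁ t₂ => t₁.eval M s = t₂.eval M s
  | .dep _ _ _ _ => True
  | .neg ψ => ¬ Tarski M s ψ
  | .or ψ θ => Tarski M s ψ ∨ Tarski M s θ
  | .ex v ψ => ∃ m : M.Dom, Tarski M (Function.update s v m) ψ

/-- The team `X[F/v] = {s[m/v] : s ∈ X, m ∈ F(s)}`. -/
def teamSup {M : Model Sig} (X : Set (ℕ → M.Dom)) (v : ℕ)
    (F : (ℕ → M.Dom) → Set M.Dom) : Set (ℕ → M.Dom) :=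
  {s' | ∃ s ∈ X, ∃ m ∈ F s, s' = Function.update s v m}

/-- The team `X[M/v] = {s[m/v] : s ∈ X, m ∈ Dom(M)}`. -/
def teamSupAll {M : Model Sig} (X : Set (ℕ → M.Dom)) (v : ℕ) : Set (ℕ → M.Dom) :=
  {s' | ∃ s ∈ X, ∃ m : M.Dom, s' = Function.update s v m}

/-- Team Semantics: `TeamSat M true X ψ` is `(M,X) ⊨⁺ ψ` and
`TeamSat M false X ψ` is `(M,X) ⊨⁻ ψ`. -/
def TeamSat (M : Model Sig) : Bool → Set (ℕ → M.Dom) → DLFormula Sig → Prop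
  | true, X, .rel R ts => ∀ s ∈ X, M.relInterp R (fun i => (ts i).eval M s)
  | false, X, .rel R ts => ∀ s ∈ X, ¬ M.relInterp R (fun i => (ts i).eval M s)
  | true, X, .eq t₁ t₂ => ∀ s ∈ X, t₁.eval M s = t₂.eval M s
  | false, X, .eq t₁ t₂ => ∀ s ∈ X, t₁.eval M s ≠ t₂.eval M s
  | true, X, .dep _ _ ts₁ ts₂ => ∀ s ∈ X, ∀ s' ∈ X,
      (∀ i, (ts₁ i).eval M s = (ts₁ i).eval M s') →
        ∀ j, (ts₂ j).eval M s = (ts₂ j).eval M s'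
  | false, X, .dep _ _ _ _ => X = ∅
  | d, X, .neg ψ => TeamSat M (!d) X ψ
  | true, X, .or ψ θ => ∃ Y Z, X = Y ∪ Z ∧ TeamSat M true Y ψ ∧ TeamSat M true Z θ
  | false, X, .or ψ θ => TeamSat M false X ψ ∧ TeamSat M false X θ
  | true, X, .ex v ψ => ∃ F : (ℕ → M.Dom) → Set M.Dom,
      (∀ s ∈ X, (F s).Nonempty) ∧ TeamSat M true (teamSup X v F) ψ
  | false, X, .ex v ψ => TeamSat M false (teamSupAll X v) ψ

/-- A fixed (arbitrary) assignment, playing the role of the empty assignment. -/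
noncomputable def Model.defAsg (M : Model Sig) : ℕ → M.Dom :=
  fun _ => Classical.choice M.nonempty

/-- Truth/falsity of a sentence: `M ⊨ᵈ φ` iff `(M, {∅}) ⊨ᵈ φ`. -/
def Model.sat (M : Model Sig) (d : Bool) (φ : DLFormula Sig) : Prop :=
  TeamSat M d {M.defAsg} φ

/-- Paraconsistent Team Semantics: `(M,X) ⊨ₚᵈ ψ` iff `(M,X) ⊭^{d*} ψ`. -/
def PTeamSat (M : Model Sig) (d : Bool) (X : Set (ℕ → M.Dom))
    (ψ : DLFormula Sig) : Prop :=
  ¬ TeamSat M (!d) X ψ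

/-- Paraconsistent truth/falsity of a sentence. -/
def Model.psat (M : Model Sig) (d : Bool) (φ : DLFormula Sig) : Prop :=
  PTeamSat M d {M.defAsg} φ

/-- A property holds throughout `X[F/v]` iff it holds at each `s[m/v]` with `s ∈ X`, `m ∈ F s`. -/
theorem forall_mem_teamSup {M : Model Sig} {X : Set (ℕ → M.Dom)} {v : ℕ}
    {F : (ℕ → M.Dom) → Set M.Dom} {p : (ℕ → M.Dom) → Prop} :
    (∀ s ∈ teamSup X v F, p s) ↔ ∀ s ∈ X, ∀ m ∈ F s, p (Function.update s v m) :=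
  ⟨fun h s hs m hm => h _ ⟨s, hs, m, hm, rfl⟩, by rintro h _ ⟨s, hs, m, hm, rfl⟩; exact h s hs m hm⟩

/-- A property holds throughout `X[M/v]` iff it holds at each `s[m/v]` with `s ∈ X`. -/
theorem forall_mem_teamSupAll {M : Model Sig} {X : Set (ℕ → M.Dom)} {v : ℕ}
    {p : (ℕ → M.Dom) → Prop} :
    (∀ s ∈ teamSupAll X v, p s) ↔ ∀ s ∈ X, ∀ m, p (Function.update s v m) :=
  ⟨fun h s hs m => h _ ⟨s, hs, m, rfl⟩, by rintro h _ ⟨s, hs, m, rfl⟩; exact h s hs m⟩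

/-- A team splits into a part satisfying `p` and a part satisfying `q` iff each of its members
satisfies `p` or `q`. -/
theorem exists_eq_union_forall_iff {α : Type*} {X : Set α} {p q : α → Prop} :
    (∃ Y Z, X = Y ∪ Z ∧ (∀ s ∈ Y, p s) ∧ ∀ s ∈ Z, q s) ↔ ∀ s ∈ X, p s ∨ q s := by
  constructor
  · rintro ⟨Y, Z, rfl, hY, hZ⟩ s (hs | hs)
    exacts [.inl (hY s hs), .inr (hZ s hs)]
  · intro h
    refine ⟨{s ∈ X | p s}, {s ∈ X | q s}, ?_, fun s hs => hs.2, fun s hs => hs.2⟩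
    ext s
    have := h s
    simp only [Set.mem_union, Set.mem_ofPred_eq]
    tauto

/-- for first-order formulas, team satisfaction is pointwise
Tarski satisfaction. -/
theorem stmt0 (Sig : Signature) (M : Model Sig) (ψ : DLFormula Sig)
    (hFO : ψ.IsFirstOrder) (X : Set (ℕ → M.Dom)) :
    (TeamSat M true X ψ ↔ ∀ s ∈ X, Tarski M s ψ) ∧
    (TeamSat M false X ψ ↔ ∀ s ∈ X, ¬ Tarski M s ψ) := by
  induction ψ generalizing X with
  | rel R ts => simp only [TeamSat, Tarski, and_self]
  | eq t₁ t₂ => simp only [TeamSat, Tarski, ne_eq, and_self]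
  | dep n m ts₁ ts₂ => exact hFO.elim
  | neg ψ ih =>
    simpa only [TeamSat, Tarski, Bool.not_true, Bool.not_false, not_not] using (ih hFO X).symm
  | or ψ θ ihψ ihθ =>
    simp only [TeamSat, Tarski, ihψ hFO.1, ihθ hFO.2, exists_eq_union_forall_iff, not_or,
      forall_and, and_self]
  | ex v ψ ih =>
    simp only [TeamSat, Tarski, ih hFO, forall_mem_teamSup, forall_mem_teamSupAll, not_exists,
      and_true]
    constructor
    · rintro ⟨F, hne, hF⟩ s hs
      exact (hne s hs).imp fun m hm => hF s hs m hm
    · exact fun h => ⟨fun s => {m | Tarski M (Function.update s v m) ψ}, h, fun _ _ _ hm => hm⟩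
end

section
/- Locality: for every Dependence Logic formula ψ, every model M, every sign d ∈ {+, −}, and all teams X₁ and X₂ over M whose restrictions to Free(ψ) coincide (i.e. {s restricted to Free(ψ) : s ∈ X₁} = {s restricted to Free(ψ) : s ∈ X₂}): (M, X₁) ⊨ᵈ ψ if and only if (M, X₂) ⊨ᵈ ψ. -/
variable {Sig : Signature}

theorem Term.eval_eq_of_eqOn_vars (M : Model Sig) {s t : ℕ → M.Dom} (τ : Term Sig)
    (h : Set.EqOn s t τ.vars) : τ.eval M s = τ.eval M t := by
  induction τ with
  | var v => exact h rfl
  | func f ts ih =>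
    simp only [Term.eval]
    congr 1
    funext i
    exact ih i (h.mono (Set.subset_iUnion (fun i => (ts i).vars) i))

/-- Every assignment in `X` agrees on `V` with some assignment in `Y`. -/
def TeamCovered {α β : Type*} (V : Set α) (X Y : Set (α → β)) : Prop :=
  ∀ s ∈ X, ∃ t ∈ Y, Set.EqOn s t V

theorem TeamCovered.mono {α β : Type*} {V W : Set α} {X Y : Set (α → β)}
    (h : TeamCovered V X Y) (hW : W ⊆ V) : TeamCovered W X Y := fun s hs =>
  let ⟨t, ht, hst⟩ := h s hs
  ⟨t, ht, hst.mono hW⟩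

theorem teamCovered_of_image_restrict_subset {α β : Type*} {V : Set α} {X Y : Set (α → β)}
    (h : (fun s => V.domRestrict s) '' X ⊆ (fun s => V.domRestrict s) '' Y) : TeamCovered V X Y := by
  intro s hs
  obtain ⟨t, ht, hts⟩ := h (Set.mem_image_of_mem _ hs)
  exact ⟨t, ht, fun v hv => (congrFun hts ⟨v, hv⟩).symm⟩

/-- The assignments of `Y` that agree on `V` with some assignment in `X`. -/
def teamMatching {α β : Type*} (V : Set α) (X Y : Set (α → β)) : Set (α → β) :=
  {t ∈ Y | ∃ s ∈ X, Set.EqOn s t V}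

theorem TeamCovered.teamMatching_right {α β : Type*} {V : Set α} {X Y : Set (α → β)}
    (h : TeamCovered V X Y) : TeamCovered V X (teamMatching V X Y) := fun s hs =>
  let ⟨t, ht, hst⟩ := h s hs
  ⟨t, ⟨ht, s, hs, hst⟩, hst⟩

theorem teamMatching_teamCovered {α β : Type*} (V : Set α) (X Y : Set (α → β)) :
    TeamCovered V (teamMatching V X Y) X := fun _ ⟨_, s, hs, hst⟩ => ⟨s, hs, hst.symm⟩

theorem teamMatching_union {α β : Type*} {V : Set α} {X₁ X₂ Y : Set (α → β)}
    (h : TeamCovered V Y (X₁ ∪ X₂)) : Y = teamMatching V X₁ Y ∪ teamMatching V X₂ Y := by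
  ext t
  refine ⟨fun ht => ?_, fun ht => ht.elim And.left And.left⟩
  obtain ⟨s, hs | hs, hst⟩ := h t ht
  · exact Or.inl ⟨ht, s, hs, hst.symm⟩
  · exact Or.inr ⟨ht, s, hs, hst.symm⟩

theorem eqOn_update_of_eqOn_diff {α β : Type*} [DecidableEq α] {V : Set α} {s t : α → β} {v : α}
    (h : Set.EqOn s t (V \ {v})) (m : β) :
    Set.EqOn (Function.update s v m) (Function.update t v m) V := by
  intro w hw
  by_cases hwv : w = v
  · subst hwv
    simp
  · simpa [Function.update_of_ne hwv] using h ⟨hw, hwv⟩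

theorem TeamCovered.supAll {M : Model Sig} {V : Set ℕ} {X Y : Set (ℕ → M.Dom)} {v : ℕ}
    (h : TeamCovered (V \ {v}) X Y) : TeamCovered V (teamSupAll X v) (teamSupAll Y v) := by
  rintro _ ⟨s, hs, m, rfl⟩
  obtain ⟨t, ht, hst⟩ := h s hs
  exact ⟨_, ⟨t, ht, m, rfl⟩, eqOn_update_of_eqOn_diff hst m⟩

theorem TeamSat.of_teamCovered {M : Model Sig} {ψ : DLFormula Sig} {d : Bool}
    {X Y : Set (ℕ → M.Dom)} (hXY : TeamCovered ψ.free X Y) (hYX : TeamCovered ψ.free Y X)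
    (h : TeamSat M d X ψ) : TeamSat M d Y ψ := by
  induction ψ generalizing d X Y with
  | rel R ts =>
    have eval_eq {s t : ℕ → M.Dom} (hst : Set.EqOn s t (DLFormula.rel R ts).free) :
        (fun i => (ts i).eval M s) = fun i => (ts i).eval M t := funext fun i =>
      (ts i).eval_eq_of_eqOn_vars M (hst.mono (Set.subset_iUnion (fun i => (ts i).vars) i))
    cases d <;>
    · intro t ht
      obtain ⟨s, hs, hts⟩ := hYX t ht
      rw [eval_eq hts]
      exact h s hs
  | eq t₁ t₂ =>
    cases d <;>
    · intro t ht
      obtain ⟨s, hs, hts⟩ := hYX t ht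
      rw [t₁.eval_eq_of_eqOn_vars M (hts.mono Set.subset_union_left),
        t₂.eval_eq_of_eqOn_vars M (hts.mono Set.subset_union_right)]
      exact h s hs
  | dep n m ts₁ ts₂ =>
    cases d with
    | false =>
      refine Set.eq_empty_of_forall_notMem fun t ht => ?_
      obtain ⟨s, hs, -⟩ := hYX t ht
      have hX : X = ∅ := h
      simp [hX] at hs
    | true =>
      have eval_eq₁ {s t : ℕ → M.Dom} (hst : Set.EqOn s t (DLFormula.dep n m ts₁ ts₂).free)
          (i : Fin n) : (ts₁ i).eval M s = (ts₁ i).eval M t :=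
        (ts₁ i).eval_eq_of_eqOn_vars M (hst.mono
          ((Set.subset_iUnion (fun i => (ts₁ i).vars) i).trans Set.subset_union_left))
      have eval_eq₂ {s t : ℕ → M.Dom} (hst : Set.EqOn s t (DLFormula.dep n m ts₁ ts₂).free)
          (j : Fin m) : (ts₂ j).eval M s = (ts₂ j).eval M t :=
        (ts₂ j).eval_eq_of_eqOn_vars M (hst.mono
          ((Set.subset_iUnion (fun j => (ts₂ j).vars) j).trans Set.subset_union_right))
      intro t ht t' ht' htt' j
      obtain ⟨s, hs, hts⟩ := hYX t ht
      obtain ⟨s', hs', hts'⟩ := hYX t' ht'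
      rw [eval_eq₂ hts, eval_eq₂ hts']
      refine h s hs s' hs' (fun i => ?_) j
      rw [← eval_eq₁ hts, ← eval_eq₁ hts']
      exact htt' i
  | neg ψ ih =>
    simp only [TeamSat] at h ⊢
    exact ih hXY hYX h
  | or ψ θ ihψ ihθ =>
    cases d with
    | false =>
      exact ⟨ihψ (hXY.mono Set.subset_union_left) (hYX.mono Set.subset_union_left) h.1,
        ihθ (hXY.mono Set.subset_union_right) (hYX.mono Set.subset_union_right) h.2⟩
    | true =>
      obtain ⟨X₁, X₂, rfl, h₁, h₂⟩ := h
      refine ⟨_, _, teamMatching_union hYX, ihψ ?_ ?_ h₁, ihθ ?_ ?_ h₂⟩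
      · exact TeamCovered.mono (TeamCovered.teamMatching_right fun s hs => hXY s (Or.inl hs))
          Set.subset_union_left
      · exact (teamMatching_teamCovered _ _ _).mono Set.subset_union_left
      · exact TeamCovered.mono (TeamCovered.teamMatching_right fun s hs => hXY s (Or.inr hs))
          Set.subset_union_right
      · exact (teamMatching_teamCovered _ _ _).mono Set.subset_union_right
  | ex v ψ ih =>
    cases d with
    | false => exact ih (TeamCovered.supAll hXY) (TeamCovered.supAll hYX) h
    | true =>
      obtain ⟨F, hF, h⟩ := h
      refine ⟨fun t => {m | ∃ s ∈ X, Set.EqOn s t (ψ.free \ {v}) ∧ m ∈ F s}, ?_, ih ?_ ?_ h⟩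
      · intro t ht
        obtain ⟨s, hs, hts⟩ := hYX t ht
        obtain ⟨m, hm⟩ := hF s hs
        exact ⟨m, s, hs, hts.symm, hm⟩
      · rintro _ ⟨s, hs, m, hm, rfl⟩
        obtain ⟨t, ht, hst⟩ := hXY s hs
        exact ⟨_, ⟨t, ht, m, ⟨s, hs, hst, hm⟩, rfl⟩, eqOn_update_of_eqOn_diff hst m⟩
      · rintro _ ⟨t, -, m, ⟨s, hs, hst, hm⟩, rfl⟩
        exact ⟨_, ⟨s, hs, m, hm, rfl⟩, eqOn_update_of_eqOn_diff hst.symm m⟩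

/-- Locality. If the restrictions of the teams `X₁`, `X₂` to
the free variables of `ψ` coincide, they satisfy the same formulas. -/
theorem stmt4 (Sig : Signature) (M : Model Sig) (ψ : DLFormula Sig) (d : Bool)
    (X₁ X₂ : Set (ℕ → M.Dom))
    (h : (fun s => (ψ.free).restrict s) '' X₁ = (fun s => (ψ.free).restrict s) '' X₂) :
    TeamSat M d X₁ ψ ↔ TeamSat M d X₂ ψ := by
  have h₁₂ := teamCovered_of_image_restrict_subset h.subset
  have h₂₁ := teamCovered_of_image_restrict_subset h.superset
  exact ⟨TeamSat.of_teamCovered h₁₂ h₂₁, TeamSat.of_teamCovered h₂₁ h₁₂⟩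
end

section
/- Downwards Closure: for every Dependence Logic formula ψ, every model M, every sign d ∈ {+, −}, and all teams X, Y over M with the same domain containing Free(ψ): if (M, X) ⊨ᵈ ψ and Y ⊆ X, then (M, Y) ⊨ᵈ ψ. -/
variable {Sig : Signature}

theorem teamSup_mono {M : Model Sig} {X Y : Set (ℕ → M.Dom)} (h : Y ⊆ X) (v : ℕ)
    (F : (ℕ → M.Dom) → Set M.Dom) : teamSup Y v F ⊆ teamSup X v F := by
  rintro _ ⟨s, hs, m, hm, rfl⟩
  exact ⟨s, h hs, m, hm, rfl⟩

theorem teamSupAll_mono {M : Model Sig} {X Y : Set (ℕ → M.Dom)} (h : Y ⊆ X) (v : ℕ) :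
    teamSupAll Y v ⊆ teamSupAll X v := by
  rintro _ ⟨s, hs, m, rfl⟩
  exact ⟨s, h hs, m, rfl⟩

/-- Downwards Closure. -/
theorem stmt5 (Sig : Signature) (M : Model Sig) (ψ : DLFormula Sig) (d : Bool)
    (X Y : Set (ℕ → M.Dom)) (hXd : TeamSat M d X ψ) (hYX : Y ⊆ X) :
    TeamSat M d Y ψ := by
  induction ψ generalizing d X Y with
  | rel R ts =>
    cases d <;> simp only [TeamSat] at hXd ⊢ <;> exact fun s hs => hXd s (hYX hs)
  | eq t₁ t₂ =>
    cases d <;> simp only [TeamSat] at hXd ⊢ <;> exact fun s hs => hXd s (hYX hs)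
  | dep n m ts₁ ts₂ =>
    cases d <;> simp only [TeamSat] at hXd ⊢
    · exact Set.subset_eq_empty hYX hXd
    · exact fun s hs s' hs' => hXd s (hYX hs) s' (hYX hs')
  | neg ψ ih =>
    simp only [TeamSat] at hXd ⊢
    exact ih _ X Y hXd hYX
  | or ψ θ ihψ ihθ =>
    cases d <;> simp only [TeamSat] at hXd ⊢
    · exact ⟨ihψ _ X Y hXd.1 hYX, ihθ _ X Y hXd.2 hYX⟩
    · obtain ⟨A, B, rfl, hA, hB⟩ := hXd
      refine ⟨Y ∩ A, Y ∩ B, ?_, ihψ _ A _ hA Set.inter_subset_right,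
        ihθ _ B _ hB Set.inter_subset_right⟩
      rw [← Set.inter_union_distrib_left, Set.inter_eq_left.mpr hYX]
  | ex v ψ ih =>
    cases d <;> simp only [TeamSat] at hXd ⊢
    · exact ih _ _ _ hXd (teamSupAll_mono hYX v)
    · obtain ⟨F, hF, h⟩ := hXd
      exact ⟨F, fun s hs => hF s (hYX hs), ih _ _ _ h (teamSup_mono hYX v F)⟩
end

section
/- Law of Non-Contradiction for Team Semantics: for every model M, every Dependence Logic formula φ over the signature of M, and every team X over M with Free(φ) ⊆ Dom(X): if (M, X) ⊨⁺ φ and (M, X) ⊨⁻ φ, then X = ∅. -/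
variable {Sig : Signature}

theorem teamSup_subset_teamSupAll {M : Model Sig} (X : Set (ℕ → M.Dom)) (v : ℕ)
    (F : (ℕ → M.Dom) → Set M.Dom) : teamSup X v F ⊆ teamSupAll X v :=
  fun _ ⟨s, hs, m, _, e⟩ => ⟨s, hs, m, e⟩

/-- Satisfaction and falsification are both downward closed in the team. -/
theorem TeamSat.mono {M : Model Sig} {φ : DLFormula Sig} {d : Bool}
    {X Y : Set (ℕ → M.Dom)} (h : Y ⊆ X) (hX : TeamSat M d X φ) : TeamSat M d Y φ := by
  induction φ generalizing d X Y with
  | rel R ts => cases d <;> exact fun s hs => hX s (h hs)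
  | eq t₁ t₂ => cases d <;> exact fun s hs => hX s (h hs)
  | dep n m ts₁ ts₂ =>
    cases d
    · exact Set.subset_eq_empty h hX
    · exact fun s hs s' hs' => hX s (h hs) s' (h hs')
  | neg ψ ih =>
    rw [TeamSat] at hX ⊢
    exact ih h hX
  | or ψ θ ihψ ihθ =>
    cases d
    · exact ⟨ihψ h hX.1, ihθ h hX.2⟩
    · obtain ⟨A, B, rfl, hA, hB⟩ := hX
      refine ⟨A ∩ Y, B ∩ Y, ?_, ihψ Set.inter_subset_left hA, ihθ Set.inter_subset_left hB⟩
      rw [← Set.union_inter_distrib_right, Set.inter_eq_right.mpr h]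
  | ex v ψ ih =>
    cases d
    · exact ih (X := teamSupAll X v) (teamSupAll_mono h v) hX
    · obtain ⟨F, hF, hψ⟩ := hX
      exact ⟨F, fun s hs => hF s (h hs), ih (teamSup_mono h v F) hψ⟩

/-- Law of Non-Contradiction for Team Semantics. -/
theorem stmt7 (Sig : Signature) (M : Model Sig) (φ : DLFormula Sig)
    (X : Set (ℕ → M.Dom)) (hp : TeamSat M true X φ) (hm : TeamSat M false X φ) :
    X = ∅ := by
  induction φ generalizing X with
  | rel R ts => exact Set.eq_empty_of_forall_notMem fun s hs => hm s hs (hp s hs)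
  | eq t₁ t₂ => exact Set.eq_empty_of_forall_notMem fun s hs => hm s hs (hp s hs)
  | dep n m ts₁ ts₂ => exact hm
  | neg ψ ih =>
    rw [TeamSat] at hp hm
    exact ih X hm hp
  | or ψ θ ihψ ihθ =>
    obtain ⟨A, B, rfl, hA, hB⟩ := hp
    rw [ihψ A hA (hm.1.mono Set.subset_union_left),
      ihθ B hB (hm.2.mono Set.subset_union_right), Set.union_empty]
  | ex v ψ ih =>
    obtain ⟨F, hF, hψ⟩ := hp
    have hempty := ih _ hψ
      (TeamSat.mono (X := teamSupAll X v) (teamSup_subset_teamSupAll X v F) hm)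
    refine Set.eq_empty_of_forall_notMem fun s hs => ?_
    obtain ⟨m, hmF⟩ := hF s hs
    exact Set.eq_empty_iff_forall_notMem.mp hempty _ ⟨s, hs, m, hmF, rfl⟩
end

section
/- For every first-order formula ψ (containing no dependence atoms), every model M of its signature, and every team X over M with Free(ψ) ⊆ Dom(X): (M,X) ⊨ₚ⁺ ψ if and only if there is some s ∈ X with M ⊨_s ψ in the sense of Tarski semantics, and (M,X) ⊨ₚ⁻ ψ if and only if there is some s ∈ X with M ⊭_s ψ in the sense of Tarski semantics. -/
variable {Sig : Signature}

/-- Flatness: a first-order formula is satisfied (resp. falsified) by a team if and only if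
it is true (resp. false) under every assignment of the team. -/
theorem teamSat_iff_forall_tarski (M : Model Sig) (ψ : DLFormula Sig) (hFO : ψ.IsFirstOrder)
    (X : Set (ℕ → M.Dom)) :
    (TeamSat M true X ψ ↔ ∀ s ∈ X, Tarski M s ψ) ∧
    (TeamSat M false X ψ ↔ ∀ s ∈ X, ¬ Tarski M s ψ) := by
  induction ψ generalizing X with
  | rel R ts => simp [TeamSat, Tarski]
  | eq t₁ t₂ => simp [TeamSat, Tarski]
  | dep n m ts₁ ts₂ => exact hFO.elim
  | neg ψ ih =>
    have h := ih hFO X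
    simp [TeamSat, Tarski, h.1, h.2]
  | or ψ θ ihψ ihθ =>
    have hψ := ihψ hFO.1
    have hθ := ihθ hFO.2
    simp only [TeamSat, Tarski, hψ, hθ]
    refine ⟨⟨?_, fun h => ⟨{s ∈ X | Tarski M s ψ}, {s ∈ X | Tarski M s θ}, ?_,
      fun s hs => hs.2, fun s hs => hs.2⟩⟩, ?_⟩
    · rintro ⟨Y, Z, rfl, hY, hZ⟩ s (hs | hs)
      · exact Or.inl (hY s hs)
      · exact Or.inr (hZ s hs)
    · ext s
      exact ⟨fun hs => (h s hs).imp (fun h => ⟨hs, h⟩) (fun h => ⟨hs, h⟩),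
        fun hs => hs.elim (fun h => h.1) (fun h => h.1)⟩
    · simp only [not_or, forall_and]
  | ex v ψ ih =>
    have h := ih hFO
    simp only [TeamSat, Tarski, h]
    refine ⟨⟨?_, fun h => ⟨fun s => {m | Tarski M (Function.update s v m) ψ}, h, ?_⟩⟩,
      fun h s hs => ?_, fun h => ?_⟩
    · rintro ⟨F, hF, hX⟩ s hs
      obtain ⟨m, hm⟩ := hF s hs
      exact ⟨m, hX _ ⟨s, hs, m, hm, rfl⟩⟩
    · rintro _ ⟨s, -, m, hm, rfl⟩
      exact hm
    · rintro ⟨m, hm⟩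
      exact h _ ⟨s, hs, m, rfl⟩ hm
    · rintro _ ⟨s, hs, m, rfl⟩ hm
      exact h s hs ⟨m, hm⟩

/-- for first-order formulas, paraconsistent team satisfaction is
existential pointwise Tarski satisfaction. -/
theorem stmt10 (Sig : Signature) (M : Model Sig) (ψ : DLFormula Sig)
    (hFO : ψ.IsFirstOrder) (X : Set (ℕ → M.Dom)) :
    (PTeamSat M true X ψ ↔ ∃ s ∈ X, Tarski M s ψ) ∧
    (PTeamSat M false X ψ ↔ ∃ s ∈ X, ¬ Tarski M s ψ) := by
  obtain ⟨hpos, hneg⟩ := teamSat_iff_forall_tarski M ψ hFO X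
  simp [PTeamSat, hpos, hneg]
end

section
/- Internal Law of Non-Contradiction in Paraconsistent Team Semantics: for every model M, every Dependence Logic formula ψ over the signature of M, and every nonempty team X over M with Free(ψ) ⊆ Dom(X): (M, X) ⊨ₚ⁺ ¬(ψ ∧ ¬ψ), where ψ ∧ ¬ψ abbreviates ¬(¬ψ ∨ ¬¬ψ). -/
variable {Sig : Signature}

/-- A team satisfying a formula and a team falsifying it share no assignment. -/
theorem TeamSat.disjoint {M : Model Sig} {ψ : DLFormula Sig} {X Y : Set (ℕ → M.Dom)}
    (hX : TeamSat M true X ψ) (hY : TeamSat M false Y ψ) : Disjoint X Y := by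
  rw [Set.disjoint_left]
  induction ψ generalizing X Y with
  | rel R ts =>
    simp only [TeamSat] at hX hY
    exact fun s hs hs' => hY s hs' (hX s hs)
  | eq t₁ t₂ =>
    simp only [TeamSat] at hX hY
    exact fun s hs hs' => hY s hs' (hX s hs)
  | dep n m ts₁ ts₂ =>
    simp only [TeamSat] at hY
    simp [hY]
  | neg ψ ih =>
    simp only [TeamSat, Bool.not_true, Bool.not_false] at hX hY
    exact fun s hs hs' => ih hY hX hs' hs
  | or ψ θ ihψ ihθ =>
    simp only [TeamSat] at hX hY
    obtain ⟨U, V, rfl, hU, hV⟩ := hX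
    rintro s (hs | hs) hs'
    · exact ihψ hU hY.1 hs hs'
    · exact ihθ hV hY.2 hs hs'
  | ex v ψ ih =>
    simp only [TeamSat] at hX hY
    obtain ⟨F, hF, hsat⟩ := hX
    intro s hs hs'
    obtain ⟨m, hm⟩ := hF s hs
    exact ih hsat hY ⟨s, hs, m, hm, rfl⟩ ⟨s, hs', m, rfl⟩

/-- internal Law of Non-Contradiction in Paraconsistent Team
Semantics: every nonempty team satisfies `¬(ψ ∧ ¬ψ)`. -/
theorem stmt12 (Sig : Signature) (M : Model Sig) (ψ : DLFormula Sig)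
    (X : Set (ℕ → M.Dom)) (hX : X.Nonempty) :
    PTeamSat M true X ((ψ.conj ψ.neg).neg) := by
  intro h
  simp only [DLFormula.conj, TeamSat, Bool.not_true, Bool.not_false] at h
  obtain ⟨s, hs⟩ := hX
  exact Set.disjoint_left.mp (h.1.disjoint h.2) hs hs
end

section
/- For every model M, every team X over M, every Dependence Logic formula ψ over the signature of M with Free(ψ) ⊆ Dom(X), and every sign d ∈ {+, −}: if (M, X) ⊨ₚᵈ ψᶠ then (M, X) ⊨ₚᵈ ψ, where ψᶠ is the flattening of ψ. -/
variable {Sig : Signature}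

/-- The flattening of a formula: dependence atoms are replaced by the
tautological atom `⊤` (rendered as `x₀ = x₀`). -/
def DLFormula.flat : DLFormula Sig → DLFormula Sig
  | .rel R ts => .rel R ts
  | .eq t₁ t₂ => .eq t₁ t₂
  | .dep _ _ _ _ => .eq (.var 0) (.var 0)
  | .neg ψ => ψ.flat.neg
  | .or ψ θ => ψ.flat.or θ.flat
  | .ex v ψ => .ex v ψ.flat

/-- Team satisfaction of a formula implies team satisfaction of its flattening. -/
theorem TeamSat.flat {M : Model Sig} {d : Bool} {X : Set (ℕ → M.Dom)} {ψ : DLFormula Sig}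
    (h : TeamSat M d X ψ) : TeamSat M d X ψ.flat := by
  induction ψ generalizing d X with
  | rel R ts => exact h
  | eq t₁ t₂ => exact h
  | dep n m ts₁ ts₂ => cases d <;> simp_all [DLFormula.flat, TeamSat]
  | neg ψ ih =>
    simp only [DLFormula.flat, TeamSat] at h ⊢
    exact ih h
  | or ψ θ ihψ ihθ =>
    cases d <;> simp only [DLFormula.flat, TeamSat] at h ⊢
    · exact ⟨ihψ h.1, ihθ h.2⟩
    · obtain ⟨Y, Z, hX, hY, hZ⟩ := h
      exact ⟨Y, Z, hX, ihψ hY, ihθ hZ⟩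
  | ex v ψ ih =>
    cases d <;> simp only [DLFormula.flat, TeamSat] at h ⊢
    · exact ih h
    · obtain ⟨F, hF, hψ⟩ := h
      exact ⟨F, hF, ih hψ⟩

/-- paraconsistent satisfaction of the flattening implies
paraconsistent satisfaction of the formula. -/
theorem stmt17 (Sig : Signature) (M : Model Sig) (X : Set (ℕ → M.Dom))
    (ψ : DLFormula Sig) (d : Bool) (h : PTeamSat M d X ψ.flat) :
    PTeamSat M d X ψ :=
  fun hψ => h hψ.flat
end
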